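/- arXiv:2102.04618 — 3 statements merged into one kernel-verified Lean document; each statement's English description precedes it below -/
import Mathlib

section
/- Let N ≥ 1 and 0 < k < N. There exists a constant C > 0 depending only on N and k such that for all x ∈ ℝ^N and all t > 0, ∫_{ℝ^N} G(x−y, t) |y|^{−k} dy ≤ C |x|^{−k}. -/
open MeasureTheory Real Set ENNReal

noncomputable def heatKernel (N : ℕ) (x : EuclideanSpace ℝ (Fin N)) (t : ℝ) : ℝ :=
  (4 * Real.pi * t) ^ (-(N : ℝ) / 2) * Real.exp (-‖x‖ ^ 2 / (4 * t))

theorem rpow_le_mul_exp {a s : ℝ} (ha : 0 < a) (hs : 0 ≤ s) : s ^ a ≤ a ^ a * exp s := by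
  have h : s ≤ a * exp (s / a) := by
    have h1 := Real.add_one_le_exp (s / a)
    calc s = a * (s / a) := by field_simp
      _ ≤ a * exp (s / a) := by gcongr; linarith
  calc s ^ a ≤ (a * exp (s / a)) ^ a := by gcongr
    _ = a ^ a * exp s := by
      rw [Real.mul_rpow ha.le (exp_pos _).le, ← Real.exp_mul, div_mul_cancel₀ _ ha.ne']

theorem heatKernel_nonneg (N : ℕ) (z : EuclideanSpace ℝ (Fin N)) {t : ℝ} (ht : 0 < t) :
    0 ≤ heatKernel N z t := by
  unfold heatKernel
  positivity

theorem heatKernel_le_norm_rpow {N : ℕ} (hN : 1 ≤ N) {z : EuclideanSpace ℝ (Fin N)} (hz : z ≠ 0)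
    {t : ℝ} (ht : 0 < t) :
    heatKernel N z t ≤ ((N / 2 : ℝ) / π) ^ (N / 2 : ℝ) * ‖z‖ ^ (-(N : ℝ)) := by
  have ha : (0 : ℝ) < N / 2 := by positivity
  have hz' : 0 < ‖z‖ := norm_pos_iff.2 hz
  set a : ℝ := N / 2 with ha_def
  set s : ℝ := ‖z‖ ^ 2 / (4 * t) with hs_def
  have hs : 0 < s := by positivity
  have h1 : 4 * π * t = π * ‖z‖ ^ 2 / s := by
    rw [hs_def]; field_simp
  have h2 : (‖z‖ ^ 2) ^ a = ‖z‖ ^ (N : ℝ) := by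
    rw [← Real.rpow_natCast, ← Real.rpow_mul hz'.le, ha_def]
    congr 1; push_cast; ring
  have h3 : heatKernel N z t = π ^ (-a) * ‖z‖ ^ (-(N : ℝ)) * s ^ a * exp (-s) := by
    unfold heatKernel
    rw [neg_div, neg_div, ← ha_def, ← hs_def, h1, Real.rpow_neg (by positivity),
      Real.div_rpow (by positivity) hs.le, Real.mul_rpow pi_pos.le (by positivity), h2,
      Real.rpow_neg pi_pos.le, Real.rpow_neg hz'.le]
    field_simp
  rw [h3]
  calc π ^ (-a) * ‖z‖ ^ (-(N : ℝ)) * s ^ a * exp (-s)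
      ≤ π ^ (-a) * ‖z‖ ^ (-(N : ℝ)) * (a ^ a * exp s) * exp (-s) := by
        gcongr
        exact rpow_le_mul_exp ha hs.le
    _ = (a / π) ^ a * ‖z‖ ^ (-(N : ℝ)) := by
      rw [Real.exp_neg, Real.div_rpow ha.le pi_pos.le, Real.rpow_neg pi_pos.le]
      field_simp

theorem integral_heatKernel (N : ℕ) {t : ℝ} (ht : 0 < t) :
    ∫ z, heatKernel N z t = 1 := by
  have h := GaussianFourier.integral_rexp_neg_mul_sq_norm (V := EuclideanSpace ℝ (Fin N))
    (b := 1 / (4 * t)) (by positivity)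
  have h' : ∀ z, heatKernel N z t
      = (4 * π * t) ^ (-(N : ℝ) / 2) * exp (-(1 / (4 * t)) * ‖z‖ ^ 2) := fun z ↦ by
    unfold heatKernel
    congr 2
    ring
  simp_rw [h', integral_const_mul, h]
  rw [finrank_euclideanSpace_fin, neg_div, Real.rpow_neg (by positivity),
    show π / (1 / (4 * t)) = 4 * π * t by field_simp]
  exact inv_mul_cancel₀ (by positivity)

theorem integrable_heatKernel (N : ℕ) {t : ℝ} (ht : 0 < t) :
    Integrable fun z ↦ heatKernel N z t :=
  .of_integral_ne_zero (by rw [integral_heatKernel N ht]; exact one_ne_zero)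

section NormRpow

variable {E : Type*} [NormedAddCommGroup E] [NormedSpace ℝ E] [FiniteDimensional ℝ E]
  [MeasurableSpace E] [BorelSpace E] (μ : Measure E) [μ.IsAddHaarMeasure]

theorem integrableOn_ball_norm_rpow_neg [Nontrivial E] {k : ℝ}
    (hk : k < Module.finrank ℝ E) {R : ℝ} (hR : 0 < R) :
    IntegrableOn (fun y : E ↦ ‖y‖ ^ (-k)) (Metric.ball 0 R) μ := by
  rw [integrableOn_fun_norm_addHaar μ (f := fun y ↦ y ^ (-k))]
  have hn : 1 ≤ Module.finrank ℝ E := Module.finrank_pos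
  refine ((intervalIntegral.integrableOn_Ioo_rpow_iff
    (s := (Module.finrank ℝ E : ℝ) - 1 - k) hR).2 (by linarith)).congr_fun ?_ measurableSet_Ioo
  intro y hy
  simp only [smul_eq_mul]
  rw [← Real.rpow_natCast, ← Real.rpow_add hy.1, Nat.cast_sub hn, Nat.cast_one, sub_eq_add_neg _ k]

theorem setIntegral_ball_norm_rpow_neg (k : ℝ) {R : ℝ} (hR : 0 < R) :
    ∫ y in Metric.ball (0 : E) R, ‖y‖ ^ (-k) ∂μ
      = R ^ (Module.finrank ℝ E) * R ^ (-k) * ∫ y in Metric.ball (0 : E) 1, ‖y‖ ^ (-k) ∂μ := by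
  have h := Measure.setIntegral_comp_smul_of_pos μ (fun y : E ↦ ‖y‖ ^ (-k)) (Metric.ball 0 1) hR
  rw [smul_unitBall_of_pos hR] at h
  simp_rw [norm_smul, Real.norm_of_nonneg hR.le, Real.mul_rpow hR.le (norm_nonneg _),
    integral_const_mul, smul_eq_mul] at h
  rw [mul_assoc, h, mul_inv_cancel_left₀ (by positivity)]

end NormRpow

theorem heatKernel_mul_norm_rpow_neg_le {N : ℕ} (hN : 1 ≤ N) {k : ℝ} (hk : 0 < k) {R : ℝ}
    (hR : 0 < R) {x : EuclideanSpace ℝ (Fin N)} (hx : ‖x‖ = 2 * R) {t : ℝ} (ht : 0 < t)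
    (y : EuclideanSpace ℝ (Fin N)) :
    heatKernel N (x - y) t * ‖y‖ ^ (-k) ≤ heatKernel N (x - y) t * R ^ (-k)
      + (Metric.ball 0 R).indicator
        (fun y ↦ ((N / 2 : ℝ) / π) ^ (N / 2 : ℝ) * R ^ (-(N : ℝ)) * ‖y‖ ^ (-k)) y := by
  have h0 := heatKernel_nonneg N (x - y) ht
  by_cases hy : y ∈ Metric.ball 0 R
  · rw [indicator_of_mem hy]
    have hy' : ‖y‖ < R := by simpa using hy
    have hxy : R ≤ ‖x - y‖ := by linarith [norm_sub_norm_le x y]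
    have h1 : heatKernel N (x - y) t ≤ ((N / 2 : ℝ) / π) ^ (N / 2 : ℝ) * R ^ (-(N : ℝ)) := by
      refine (heatKernel_le_norm_rpow hN (norm_pos_iff.1 (hR.trans_le hxy)) ht).trans ?_
      gcongr ?_ * ?_
      exact Real.rpow_le_rpow_of_nonpos hR hxy (by simp)
    have h2 : 0 ≤ heatKernel N (x - y) t * R ^ (-k) := by positivity
    have h3 := mul_le_mul_of_nonneg_right h1 (Real.rpow_nonneg (norm_nonneg y) (-k))
    linarith
  · rw [indicator_of_notMem hy, add_zero]
    have hy' : R ≤ ‖y‖ := by simpa using hy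
    exact mul_le_mul_of_nonneg_left (Real.rpow_le_rpow_of_nonpos hR hy' (by linarith)) h0

theorem statement11 (N : ℕ) (hN : 1 ≤ N) (k : ℝ) (hk0 : 0 < k) (hkN : k < N) :
    ∃ C : ℝ, 0 < C ∧
      ∀ (x : EuclideanSpace ℝ (Fin N)) (t : ℝ), 0 < t →
        ∫⁻ y, ENNReal.ofReal (heatKernel N (x - y) t) * (‖y‖₊ : ℝ≥0∞) ^ (-k)
          ≤ ENNReal.ofReal C * (‖x‖₊ : ℝ≥0∞) ^ (-k) := by
  have : Nonempty (Fin N) := ⟨⟨0, hN⟩⟩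
  have hcoe : ∀ y : EuclideanSpace ℝ (Fin N), y ≠ 0 →
      (‖y‖₊ : ℝ≥0∞) ^ (-k) = ENNReal.ofReal (‖y‖ ^ (-k)) := fun y hy ↦ by
    rw [← ENNReal.ofReal_rpow_of_pos (norm_pos_iff.2 hy), ofReal_norm, enorm_eq_nnnorm]
  set A : ℝ := ((N / 2 : ℝ) / π) ^ (N / 2 : ℝ)
  set I : ℝ := ∫ y in Metric.ball (0 : EuclideanSpace ℝ (Fin N)) 1, ‖y‖ ^ (-k)
  have hA : 0 ≤ A := by positivity
  have hI : 0 ≤ I := integral_nonneg fun y ↦ by positivity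
  refine ⟨(1 + A * I) * 2 ^ k, by positivity, fun x t ht ↦ ?_⟩
  have hC : 0 < (1 + A * I) * 2 ^ k := by positivity
  rcases eq_or_ne x 0 with rfl | hx
  · simp [ENNReal.zero_rpow_of_neg (neg_lt_zero.2 hk0), ENNReal.mul_top, hC]
  obtain ⟨R, hxR⟩ : ∃ R, ‖x‖ = 2 * R := ⟨‖x‖ / 2, by ring⟩
  have hR : 0 < R := by linarith [norm_pos_iff.2 hx]
  set F : EuclideanSpace ℝ (Fin N) → ℝ := fun y ↦ heatKernel N (x - y) t * R ^ (-k)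
      + (Metric.ball 0 R).indicator (fun y ↦ A * R ^ (-(N : ℝ)) * ‖y‖ ^ (-k)) y
  have hF1 : Integrable fun y ↦ heatKernel N (x - y) t * R ^ (-k) :=
    ((integrable_heatKernel N ht).comp_sub_left x).mul_const _
  have hF2 : Integrable ((Metric.ball (0 : EuclideanSpace ℝ (Fin N)) R).indicator
      fun y ↦ A * R ^ (-(N : ℝ)) * ‖y‖ ^ (-k)) :=
    (integrable_indicator_iff measurableSet_ball).2
      ((integrableOn_ball_norm_rpow_neg volume (by simpa using hkN) hR).const_mul _)
  have hFle := heatKernel_mul_norm_rpow_neg_le hN hk0 hR hxR ht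
  have hF0 : ∀ y, 0 ≤ F y := fun y ↦
    (mul_nonneg (heatKernel_nonneg N (x - y) ht) (by positivity)).trans (hFle y)
  have hF : Integrable F := hF1.add hF2
  have hFint : ∫ y, F y = (1 + A * I) * 2 ^ k * ‖x‖ ^ (-k) := by
    rw [integral_add hF1 hF2, integral_mul_const,
      integral_sub_left_eq_self (fun z ↦ heatKernel N z t) volume x, integral_heatKernel N ht,
      integral_indicator measurableSet_ball, integral_const_mul, setIntegral_ball_norm_rpow_neg _ _ hR,
      finrank_euclideanSpace_fin, hxR, Real.mul_rpow zero_le_two hR.le, Real.rpow_neg hR.le (N : ℝ),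
      Real.rpow_natCast, Real.rpow_neg zero_le_two]
    field_simp
    rfl
  calc ∫⁻ y, ENNReal.ofReal (heatKernel N (x - y) t) * (‖y‖₊ : ℝ≥0∞) ^ (-k)
      ≤ ∫⁻ y, ENNReal.ofReal (F y) := by
        refine lintegral_mono_ae ?_
        filter_upwards [Measure.ae_ne volume 0] with y hy
        rw [hcoe y hy, ← ENNReal.ofReal_mul (heatKernel_nonneg N _ ht)]
        exact ENNReal.ofReal_le_ofReal (hFle y)
    _ = ENNReal.ofReal ((1 + A * I) * 2 ^ k) * (‖x‖₊ : ℝ≥0∞) ^ (-k) := by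
      rw [← ofReal_integral_eq_lintegral_ofReal hF (.of_forall hF0), hFint, hcoe x hx,
        ENNReal.ofReal_mul hC.le]
end

section
/- Let N ≥ 1 and let φ ∈ L¹_loc(ℝ^N) be a nonnegative function. There exists a constant C > 0 depending only on N such that for all x ∈ ℝ^N and all t > 0, ∫_{ℝ^N} G(x−y, t) φ(y) dy ≤ C t^{−N/2} sup_{ζ ∈ ℝ^N} ∫_{B(ζ, t^{1/2})} φ(y) dy, where B(ζ, r) is the open ball of radius r centered at ζ. -/
open MeasureTheory Real Set ENNReal

theorem exp_neg_norm_sq_le_of_norm_sub_le {E : Type*} [SeminormedAddCommGroup E] {t : ℝ}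
    (ht : 0 < t) (x y z : E) (hyz : ‖y - z‖ ^ 2 ≤ t) :
    Real.exp (-‖x - y‖ ^ 2 / (4 * t)) ≤
      Real.exp (1 / 4) * Real.exp (-(1 / (8 * t)) * ‖z - x‖ ^ 2) := by
  rw [← Real.exp_add]
  apply Real.exp_le_exp.mpr
  have h1 : ‖z - x‖ ≤ ‖x - y‖ + ‖y - z‖ := by
    rw [norm_sub_rev z x]
    exact norm_sub_le_norm_sub_add_norm_sub x y z
  have h2 : ‖z - x‖ ^ 2 ≤ 2 * ‖x - y‖ ^ 2 + 2 * t := by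
    nlinarith [sq_nonneg (‖x - y‖ - ‖y - z‖), norm_nonneg (z - x)]
  have h3 : 1 / 4 + -(1 / (8 * t)) * ‖z - x‖ ^ 2 - -‖x - y‖ ^ 2 / (4 * t)
      = (2 * ‖x - y‖ ^ 2 + 2 * t - ‖z - x‖ ^ 2) / (8 * t) := by
    field_simp
    ring
  have h4 : 0 ≤ (2 * ‖x - y‖ ^ 2 + 2 * t - ‖z - x‖ ^ 2) / (8 * t) :=
    div_nonneg (by linarith) (by positivity)
  linarith

theorem lintegral_exp_neg_mul_norm_sub_sq {E : Type*} [NormedAddCommGroup E]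
    [InnerProductSpace ℝ E] [FiniteDimensional ℝ E] [MeasurableSpace E] [BorelSpace E]
    {b : ℝ} (hb : 0 < b) (x : E) :
    ∫⁻ z : E, ENNReal.ofReal (Real.exp (-b * ‖z - x‖ ^ 2)) =
      ENNReal.ofReal ((Real.pi / b) ^ (Module.finrank ℝ E / 2 : ℝ)) := by
  rw [lintegral_sub_right_eq_self (fun z : E => ENNReal.ofReal (Real.exp (-b * ‖z‖ ^ 2))) x,
    ← GaussianFourier.integral_rexp_neg_mul_sq_norm hb, ofReal_integral_eq_lintegral_ofReal]
  · have h := GaussianFourier.integrable_cexp_neg_mul_sq_norm_add (V := E) (b := b)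
      (by simpa using hb) 0 0
    convert h.re using 2 with v
    simp [← Complex.ofReal_pow, ← Complex.ofReal_mul, ← Complex.ofReal_neg, Complex.exp_ofReal_re]
  · exact Filter.Eventually.of_forall fun v => (Real.exp_pos _).le

theorem lintegral_setLIntegral_ball_comm {E : Type*} [PseudoMetricSpace E]
    [SecondCountableTopology E] [MeasurableSpace E] [BorelSpace E] (μ ν : Measure E)
    [SFinite μ] [SFinite ν] {h : E → ℝ≥0∞} (hh : Measurable h) (r : ℝ) :
    ∫⁻ y, ∫⁻ z in Metric.ball y r, h z ∂μ ∂ν = ∫⁻ z, h z * ν (Metric.ball z r) ∂μ := by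
  have hS : MeasurableSet {p : E × E | dist p.2 p.1 < r} :=
    measurableSet_lt (measurable_snd.dist measurable_fst) measurable_const
  calc ∫⁻ y, ∫⁻ z in Metric.ball y r, h z ∂μ ∂ν
      = ∫⁻ y, ∫⁻ z, {p : E × E | dist p.2 p.1 < r}.indicator (fun p => h p.2) (y, z) ∂μ ∂ν := by
        refine lintegral_congr fun y => ?_
        rw [← lintegral_indicator Metric.isOpen_ball.measurableSet]
        rfl
    _ = ∫⁻ z, ∫⁻ y, {p : E × E | dist p.2 p.1 < r}.indicator (fun p => h p.2) (y, z) ∂ν ∂μ :=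
        lintegral_lintegral_swap ((hh.comp measurable_snd).indicator hS).aemeasurable
    _ = ∫⁻ z, h z * ν (Metric.ball z r) ∂μ := by
        refine lintegral_congr fun z => ?_
        rw [← lintegral_indicator_const Metric.isOpen_ball.measurableSet]
        refine lintegral_congr fun y => ?_
        simp [Set.indicator, dist_comm]

theorem volume_ball_mul_lintegral_exp_neg_norm_sq_le {E : Type*} [NormedAddCommGroup E]
    [InnerProductSpace ℝ E] [FiniteDimensional ℝ E] [MeasurableSpace E] [BorelSpace E]
    (ν : Measure E) [SFinite ν] (x : E) {t : ℝ} (ht : 0 < t) :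
    volume (Metric.ball (0 : E) (√t)) *
        ∫⁻ y, ENNReal.ofReal (Real.exp (-‖x - y‖ ^ 2 / (4 * t))) ∂ν ≤
      ENNReal.ofReal (Real.exp (1 / 4) * (8 * Real.pi * t) ^ (Module.finrank ℝ E / 2 : ℝ)) *
        ⨆ ζ : E, ν (Metric.ball ζ (√t)) := by
  set h : E → ℝ≥0∞ := fun z =>
    ENNReal.ofReal (Real.exp (1 / 4) * Real.exp (-(1 / (8 * t)) * ‖z - x‖ ^ 2)) with hdef
  have hh : Measurable h := by fun_prop
  calc volume (Metric.ball (0 : E) (√t)) *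
        ∫⁻ y, ENNReal.ofReal (Real.exp (-‖x - y‖ ^ 2 / (4 * t))) ∂ν
      = ∫⁻ y, ∫⁻ _ in Metric.ball y (√t),
          ENNReal.ofReal (Real.exp (-‖x - y‖ ^ 2 / (4 * t))) ∂volume ∂ν := by
        rw [← lintegral_const_mul _ (by fun_prop)]
        refine lintegral_congr fun y => ?_
        rw [setLIntegral_const, Measure.addHaar_ball_center _ y, mul_comm]
    _ ≤ ∫⁻ y, ∫⁻ z in Metric.ball y (√t), h z ∂volume ∂ν := by
        refine lintegral_mono fun y => setLIntegral_mono hh fun z hz => ?_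
        refine ENNReal.ofReal_le_ofReal (exp_neg_norm_sq_le_of_norm_sub_le ht x y z ?_)
        rw [Metric.mem_ball, dist_comm, dist_eq_norm] at hz
        exact ((Real.lt_sqrt (norm_nonneg _)).mp hz).le
    _ = ∫⁻ z, h z * ν (Metric.ball z (√t)) := lintegral_setLIntegral_ball_comm _ _ hh _
    _ ≤ ∫⁻ z, h z * ⨆ ζ : E, ν (Metric.ball ζ (√t)) :=
        lintegral_mono fun z => by gcongr; exact le_iSup (fun ζ => ν (Metric.ball ζ (√t))) z
    _ = _ := by
        rw [lintegral_mul_const _ hh]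
        congr 1
        simp only [hdef, ENNReal.ofReal_mul (Real.exp_pos _).le]
        rw [lintegral_const_mul _ (by fun_prop),
          lintegral_exp_neg_mul_norm_sub_sq (by positivity)]
        congr 3
        field_simp

theorem statement13 (N : ℕ) (hN : 1 ≤ N) :
    ∃ C : ℝ, 0 < C ∧
      ∀ (φ : EuclideanSpace ℝ (Fin N) → ℝ),
        LocallyIntegrable φ volume → (∀ x, 0 ≤ φ x) →
        ∀ (x : EuclideanSpace ℝ (Fin N)) (t : ℝ), 0 < t →
          ∫⁻ y, ENNReal.ofReal (heatKernel N (x - y) t * φ y)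
            ≤ ENNReal.ofReal (C * t ^ (-(N : ℝ) / 2)) *
                ⨆ ζ : EuclideanSpace ℝ (Fin N),
                  ∫⁻ y in Metric.ball ζ (t ^ ((1 : ℝ) / 2)), ENNReal.ofReal (φ y) := by
  set V : ℝ := volume.real (Metric.ball (0 : EuclideanSpace ℝ (Fin N)) 1) with hV
  have hV0 : 0 < V :=
    ENNReal.toReal_pos (Metric.measure_ball_pos _ _ one_pos).ne' measure_ball_lt_top.ne
  refine ⟨(4 * Real.pi) ^ (-(N : ℝ) / 2) *
    (Real.exp (1 / 4) * (8 * Real.pi) ^ ((N : ℝ) / 2)) / V, by positivity, ?_⟩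
  intro φ hφ _ x t ht
  have hm : AEMeasurable (fun y => ENNReal.ofReal (φ y)) volume :=
    hφ.aestronglyMeasurable.aemeasurable.ennreal_ofReal
  have key := volume_ball_mul_lintegral_exp_neg_norm_sq_le
    (volume.withDensity fun y => ENNReal.ofReal (φ y)) x ht
  simp only [withDensity_apply _ Metric.isOpen_ball.measurableSet,
    finrank_euclideanSpace, Fintype.card_fin] at key
  rw [lintegral_withDensity_eq_lintegral_mul₀ hm (by fun_prop)] at key
  have hvol : volume (Metric.ball (0 : EuclideanSpace ℝ (Fin N)) (√t)) =
      ENNReal.ofReal (t ^ ((N : ℝ) / 2) * V) := by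
    rw [Measure.addHaar_ball_of_pos _ _ (Real.sqrt_pos.mpr ht), finrank_euclideanSpace, Fintype.card_fin,
      ENNReal.ofReal_mul (by positivity), hV, ofReal_measureReal measure_ball_lt_top.ne,
      Real.sqrt_eq_rpow, ← Real.rpow_natCast, ← Real.rpow_mul ht.le]
    congr 3
    ring
  have hW : 0 < t ^ ((N : ℝ) / 2) * V := by positivity
  rw [hvol] at key
  rw [← Real.sqrt_eq_rpow]
  set S := ⨆ ζ : EuclideanSpace ℝ (Fin N),
    ∫⁻ y in Metric.ball ζ (√t), ENNReal.ofReal (φ y)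
  have hker : ∫⁻ y, ENNReal.ofReal (heatKernel N (x - y) t * φ y) =
      ENNReal.ofReal ((4 * Real.pi * t) ^ (-(N : ℝ) / 2)) *
        ∫⁻ y, ((fun y => ENNReal.ofReal (φ y)) *
          fun y => ENNReal.ofReal (Real.exp (-‖x - y‖ ^ 2 / (4 * t)))) y := by
    rw [← lintegral_const_mul' _ _ ENNReal.ofReal_ne_top]
    refine lintegral_congr fun y => ?_
    rw [heatKernel, ENNReal.ofReal_mul (by positivity), ENNReal.ofReal_mul (by positivity),
      Pi.mul_apply, mul_assoc, mul_comm (ENNReal.ofReal (φ y))]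
  have hconst : t ^ ((N : ℝ) / 2) * V * ((4 * Real.pi) ^ (-(N : ℝ) / 2) *
      (Real.exp (1 / 4) * (8 * Real.pi) ^ ((N : ℝ) / 2)) / V * t ^ (-(N : ℝ) / 2)) =
      (4 * Real.pi * t) ^ (-(N : ℝ) / 2) *
        (Real.exp (1 / 4) * (8 * Real.pi * t) ^ ((N : ℝ) / 2)) := by
    rw [Real.mul_rpow (by positivity) ht.le, Real.mul_rpow (x := 8 * Real.pi) (by positivity) ht.le]
    field_simp
  rw [← ENNReal.mul_le_mul_iff_right (ENNReal.ofReal_pos.mpr hW).ne' ENNReal.ofReal_ne_top,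
    hker, ← mul_assoc _ _ S, ← ENNReal.ofReal_mul hW.le, hconst,
    ENNReal.ofReal_mul (p := (4 * Real.pi * t) ^ (-(N : ℝ) / 2)) (by positivity), mul_left_comm,
    mul_assoc _ _ S]
  gcongr
end

section
/- Let N ≥ 1 and k > 0. There exists a constant C > 0 depending only on N and k such that for all x ∈ ℝ^N and all t > 0, ∫_{ℝ^N} G(x−y, t) |y|^{−N} (log(e+|y|^{−1}))^{−k−1} χ₁(|y|) dy ≤ C t^{−N/2} (log(e+t^{−1/2}))^{−k}. -/
open MeasureTheory Real Set ENNReal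

lemma one_le_log_exp_one_add_inv {r : ℝ} (hr : 0 ≤ r) : 1 ≤ Real.log (Real.exp 1 + r⁻¹) := by
  rw [Real.le_log_iff_exp_le (by positivity)]
  exact le_add_of_nonneg_right (inv_nonneg.2 hr)

lemma log_exp_one_add_inv_anti {s r : ℝ} (hs : 0 < s) (hsr : s ≤ r) :
    Real.log (Real.exp 1 + r⁻¹) ≤ Real.log (Real.exp 1 + s⁻¹) := by
  have hr : 0 < r := hs.trans_le hsr
  gcongr

lemma log_exp_one_add_inv_le {s r : ℝ} (hs : 0 < s) (hsr : s ≤ r) :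
    Real.log (Real.exp 1 + s⁻¹) ≤ (1 + Real.log (r / s)) * Real.log (Real.exp 1 + r⁻¹) := by
  have hr : 0 < r := hs.trans_le hsr
  have hrs : 1 ≤ r / s := (one_le_div hs).2 hsr
  have h1 : Real.exp 1 + s⁻¹ ≤ r / s * (Real.exp 1 + r⁻¹) := by
    have : r / s * r⁻¹ = s⁻¹ := by field_simp
    rw [mul_add, this]
    gcongr
    exact le_mul_of_one_le_left (by positivity) hrs
  have h2 : Real.log (Real.exp 1 + s⁻¹) ≤ Real.log (r / s) + Real.log (Real.exp 1 + r⁻¹) := by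
    rw [← Real.log_mul (by positivity) (by positivity)]
    exact Real.log_le_log (by positivity) h1
  nlinarith [one_le_log_exp_one_add_inv hr.le, Real.log_nonneg hrs]

/-- Up to a constant, `r ↦ r ^ (-a) * log (e + r⁻¹) ^ (-k)` is decreasing on `(0, ∞)`. -/
lemma rpow_neg_mul_log_rpow_neg_le {a k s r : ℝ} (ha : 0 < a) (hk : 0 < k) (hs : 0 < s)
    (hsr : s ≤ r) :
    r ^ (-a) * Real.log (Real.exp 1 + r⁻¹) ^ (-k) ≤
      (1 + k / a) ^ k * (s ^ (-a) * Real.log (Real.exp 1 + s⁻¹) ^ (-k)) := by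
  have hr : 0 < r := hs.trans_le hsr
  have hrs : 1 ≤ r / s := (one_le_div hs).2 hsr
  have hLr := one_le_log_exp_one_add_inv hr.le
  have hLs := one_le_log_exp_one_add_inv hs.le
  have hlog : 1 + Real.log (r / s) ≤ (1 + k / a) * (r / s) ^ (a / k) := by
    have h1 := Real.log_le_rpow_div (zero_le_one.trans hrs) (div_pos ha hk)
    have h2 := Real.one_le_rpow hrs (div_pos ha hk).le
    have h3 : (r / s) ^ (a / k) / (a / k) = k / a * (r / s) ^ (a / k) := by field_simp
    linarith
  have hL : Real.log (Real.exp 1 + s⁻¹) ≤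
      (1 + k / a) * (r / s) ^ (a / k) * Real.log (Real.exp 1 + r⁻¹) :=
    (log_exp_one_add_inv_le hs hsr).trans (by gcongr)
  have hpow : Real.log (Real.exp 1 + s⁻¹) ^ k ≤
      (1 + k / a) ^ k * (r ^ a / s ^ a) * Real.log (Real.exp 1 + r⁻¹) ^ k := by
    refine (Real.rpow_le_rpow (by positivity) hL hk.le).trans_eq ?_
    rw [Real.mul_rpow (by positivity) (by positivity), Real.mul_rpow (by positivity) (by positivity),
      ← Real.rpow_mul (by positivity), div_mul_cancel₀ _ hk.ne', Real.div_rpow hr.le hs.le]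
  have hLr' : 0 < Real.log (Real.exp 1 + r⁻¹) ^ k := by positivity
  have hLs' : 0 < Real.log (Real.exp 1 + s⁻¹) ^ k := by positivity
  have hra : 0 < r ^ a := by positivity
  have hsa : 0 < s ^ a := by positivity
  rw [Real.rpow_neg hr.le, Real.rpow_neg hs.le, Real.rpow_neg (by positivity),
    Real.rpow_neg (by positivity), ← mul_inv, ← mul_inv, ← div_eq_mul_inv, inv_eq_one_div,
    div_le_div_iff₀ (by positivity) (by positivity), one_mul]
  calc s ^ a * Real.log (Real.exp 1 + s⁻¹) ^ k
      ≤ s ^ a * ((1 + k / a) ^ k * (r ^ a / s ^ a) * Real.log (Real.exp 1 + r⁻¹) ^ k) := by gcongr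
    _ = (1 + k / a) ^ k * (r ^ a * Real.log (Real.exp 1 + r⁻¹) ^ k) := by field_simp

lemma hasDerivAt_log_exp_one_add_inv_rpow_neg {k r : ℝ} (hr : 0 < r) :
    HasDerivAt (fun r : ℝ => Real.log (Real.exp 1 + r⁻¹) ^ (-k))
      (k * (r * (Real.exp 1 * r + 1))⁻¹ * Real.log (Real.exp 1 + r⁻¹) ^ (-k - 1)) r := by
  have hL : Real.log (Real.exp 1 + r⁻¹) ≠ 0 :=
    (zero_lt_one.trans_le (one_le_log_exp_one_add_inv hr.le)).ne'
  have h := (((hasDerivAt_inv hr.ne').const_add (Real.exp 1)).log (by positivity)).rpow_const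
    (p := -k) (Or.inl hL)
  convert! h using 1
  have : Real.exp 1 + r⁻¹ ≠ 0 := by positivity
  have : Real.exp 1 * r + 1 ≠ 0 := by positivity
  field_simp

lemma lintegral_Ioc_inv_mul_log_rpow_le {k ρ : ℝ} (hk : 0 < k) (hρ1 : ρ ≤ 1) :
    ∫⁻ r in Ioc 0 ρ, ENNReal.ofReal (r⁻¹ * Real.log (Real.exp 1 + r⁻¹) ^ (-k - 1)) ≤
      ENNReal.ofReal ((Real.exp 1 + 1) / k * Real.log (Real.exp 1 + ρ⁻¹) ^ (-k)) := by
  set F : ℝ → ℝ := fun r => Real.log (Real.exp 1 + r⁻¹) ^ (-k) with hF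
  set F' : ℝ → ℝ := fun r =>
    k * (r * (Real.exp 1 * r + 1))⁻¹ * Real.log (Real.exp 1 + r⁻¹) ^ (-k - 1) with hF'
  have hmono : MonotoneOn F (Ioc 0 ρ) := by
    intro s hs r hr hsr
    have := one_le_log_exp_one_add_inv hr.1.le
    exact Real.rpow_le_rpow_of_nonpos (by positivity) (log_exp_one_add_inv_anti hs.1 hsr)
      (by linarith)
  have himage : F '' Ioc 0 ρ ⊆ Icc 0 (F ρ) := by
    rintro _ ⟨r, hr, rfl⟩
    have := one_le_log_exp_one_add_inv hr.1.le
    exact ⟨by positivity, hmono hr ⟨hr.1.trans_le hr.2, le_rfl⟩ hr.2⟩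
  calc ∫⁻ r in Ioc 0 ρ, ENNReal.ofReal (r⁻¹ * Real.log (Real.exp 1 + r⁻¹) ^ (-k - 1))
      ≤ ∫⁻ r in Ioc 0 ρ, ENNReal.ofReal ((Real.exp 1 + 1) / k) * ENNReal.ofReal (F' r) := by
        refine setLIntegral_mono' measurableSet_Ioc fun r hr => ?_
        rw [← ENNReal.ofReal_mul (by positivity)]
        refine ENNReal.ofReal_le_ofReal ?_
        have hr0 := hr.1
        have := one_le_log_exp_one_add_inv hr.1.le
        have h1 : (Real.exp 1 + 1) / k * F' r = r⁻¹ * Real.log (Real.exp 1 + r⁻¹) ^ (-k - 1) *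
            ((Real.exp 1 + 1) / (Real.exp 1 * r + 1)) := by
          simp only [hF']
          field_simp
        rw [h1]
        refine le_mul_of_one_le_right (by positivity) ?_
        rw [one_le_div (by positivity)]
        nlinarith [Real.exp_pos 1, hr.2]
    _ = ENNReal.ofReal ((Real.exp 1 + 1) / k) * ∫⁻ r in Ioc 0 ρ, ENNReal.ofReal (F' r) :=
        lintegral_const_mul' _ _ ENNReal.ofReal_ne_top
    _ = ENNReal.ofReal ((Real.exp 1 + 1) / k) * volume (F '' Ioc 0 ρ) := by
        rw [lintegral_deriv_eq_volume_image_of_monotoneOn measurableSet_Ioc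
          (fun r hr => (hasDerivAt_log_exp_one_add_inv_rpow_neg hr.1).hasDerivWithinAt) hmono]
    _ ≤ ENNReal.ofReal ((Real.exp 1 + 1) / k) * ENNReal.ofReal (F ρ) := by
        gcongr
        exact (measure_mono himage).trans_eq (by rw [Real.volume_Icc, sub_zero])
    _ = _ := (ENNReal.ofReal_mul (by positivity)).symm

/-- Polar coordinates for the lower Lebesgue integral of a nonnegative radial function. -/
lemma lintegral_ofReal_fun_norm_le {E : Type*} [NormedAddCommGroup E] [NormedSpace ℝ E]
    [FiniteDimensional ℝ E] [Nontrivial E] [MeasurableSpace E] [BorelSpace E] (μ : Measure E)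
    [μ.IsAddHaarMeasure] {f : ℝ → ℝ} (hf : Measurable f) (hf0 : ∀ r, 0 ≤ f r) {B : ℝ}
    (hB : 0 ≤ B)
    (h : ∫⁻ r in Ioi (0 : ℝ), ENNReal.ofReal (r ^ (Module.finrank ℝ E - 1) * f r) ≤
      ENNReal.ofReal B) :
    ∫⁻ x, ENNReal.ofReal (f ‖x‖) ∂μ ≤
      ENNReal.ofReal (Module.finrank ℝ E * μ.real (Metric.ball 0 1) * B) := by
  have hnn : 0 ≤ᵐ[volume.restrict (Ioi (0 : ℝ))]
      fun r => r ^ (Module.finrank ℝ E - 1) * f r := by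
    filter_upwards [ae_restrict_mem measurableSet_Ioi] with r hr
    exact mul_nonneg (pow_nonneg (le_of_lt hr) _) (hf0 r)
  have hint : IntegrableOn (fun r : ℝ => r ^ (Module.finrank ℝ E - 1) * f r) (Ioi 0) := by
    refine ⟨by fun_prop, ?_⟩
    rw [hasFiniteIntegral_iff_ofReal hnn]
    exact h.trans_lt ENNReal.ofReal_lt_top
  rw [← ofReal_integral_eq_lintegral_ofReal ((integrable_fun_norm_addHaar μ).2 hint)
    (Filter.Eventually.of_forall fun x => hf0 _), integral_fun_norm_addHaar]
  refine ENNReal.ofReal_le_ofReal ?_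
  rw [nsmul_eq_mul, smul_eq_mul, ← mul_assoc]
  gcongr
  rw [← ofReal_integral_eq_lintegral_ofReal hint hnn] at h
  exact (ENNReal.ofReal_le_ofReal_iff hB).1 h

lemma lintegral_norm_rpow_mul_log_le {N : ℕ} (hN : 1 ≤ N) {k ρ : ℝ} (hk : 0 < k) (hρ0 : 0 < ρ)
    (hρ1 : ρ ≤ 1) :
    ∫⁻ y : EuclideanSpace ℝ (Fin N), ENNReal.ofReal ((Ioc 0 ρ).indicator
        (fun r : ℝ => r ^ (-(N : ℝ)) * Real.log (Real.exp 1 + r⁻¹) ^ (-k - 1)) ‖y‖) ≤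
      ENNReal.ofReal (N * volume.real (Metric.ball (0 : EuclideanSpace ℝ (Fin N)) 1) *
        ((Real.exp 1 + 1) / k * Real.log (Real.exp 1 + ρ⁻¹) ^ (-k))) := by
  have : Nonempty (Fin N) := ⟨⟨0, hN⟩⟩
  have hLρ := one_le_log_exp_one_add_inv hρ0.le
  have hmain := lintegral_ofReal_fun_norm_le (volume : Measure (EuclideanSpace ℝ (Fin N)))
    (f := (Ioc 0 ρ).indicator
      (fun r : ℝ => r ^ (-(N : ℝ)) * Real.log (Real.exp 1 + r⁻¹) ^ (-k - 1)))
    (B := (Real.exp 1 + 1) / k * Real.log (Real.exp 1 + ρ⁻¹) ^ (-k))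
    (Measurable.indicator (by fun_prop) measurableSet_Ioc)
    (fun r => indicator_nonneg (fun r hr => by
      have := one_le_log_exp_one_add_inv hr.1.le
      have := hr.1
      positivity) r) (by positivity) ?_
  · simpa using hmain
  refine le_trans (le_of_eq ?_) (lintegral_Ioc_inv_mul_log_rpow_le hk hρ1)
  rw [← lintegral_indicator measurableSet_Ioi, ← lintegral_indicator measurableSet_Ioc]
  refine lintegral_congr fun r => ?_
  by_cases hr : r ∈ Ioc 0 ρ
  · have hr0 : r ∈ Ioi (0 : ℝ) := hr.1
    rw [indicator_of_mem hr, indicator_of_mem hr0, indicator_of_mem hr, ← mul_assoc]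
    congr 2
    rw [finrank_euclideanSpace_fin, ← Real.rpow_natCast, ← Real.rpow_add hr.1,
      Nat.cast_sub hN, ← Real.rpow_neg_one]
    congr 1
    push_cast
    ring
  · by_cases hr0 : r ∈ Ioi (0 : ℝ)
    · rw [indicator_of_notMem hr, indicator_of_mem hr0, indicator_of_notMem hr]
      simp
    · rw [indicator_of_notMem hr, indicator_of_notMem hr0]

lemma heatKernel_le {N : ℕ} (x : EuclideanSpace ℝ (Fin N)) {t : ℝ} (ht : 0 < t) :
    heatKernel N x t ≤ t ^ (-(N : ℝ) / 2) := by
  have h1 : Real.exp (-‖x‖ ^ 2 / (4 * t)) ≤ 1 :=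
    Real.exp_le_one_iff.2 (div_nonpos_of_nonpos_of_nonneg (by simp) (by positivity))
  have h2 : (4 * Real.pi * t) ^ (-(N : ℝ) / 2) ≤ t ^ (-(N : ℝ) / 2) := by
    refine Real.rpow_le_rpow_of_nonpos ht (le_mul_of_one_le_left ht.le ?_) ?_
    · linarith [Real.pi_gt_three]
    · have : (0 : ℝ) ≤ N := N.cast_nonneg
      linarith
  unfold heatKernel
  exact (mul_le_of_le_one_right (by positivity) h1).trans h2

lemma lintegral_heatKernel (N : ℕ) {t : ℝ} (ht : 0 < t) :
    ∫⁻ x, ENNReal.ofReal (heatKernel N x t) = 1 := by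
  have hb : 0 < (4 * t)⁻¹ := by positivity
  have hint := GaussianFourier.integral_rexp_neg_mul_sq_norm
    (V := EuclideanSpace ℝ (Fin N)) hb
  have hpos : 0 < (Real.pi / (4 * t)⁻¹) ^ ((Module.finrank ℝ (EuclideanSpace ℝ (Fin N)) : ℝ) / 2) :=
    by positivity
  have hI : Integrable fun v : EuclideanSpace ℝ (Fin N) => Real.exp (-(4 * t)⁻¹ * ‖v‖ ^ 2) := by
    by_contra h
    rw [integral_undef h] at hint
    exact hpos.ne hint
  have heq : ∀ x : EuclideanSpace ℝ (Fin N), heatKernel N x t =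
      (4 * Real.pi * t) ^ (-(N : ℝ) / 2) * Real.exp (-(4 * t)⁻¹ * ‖x‖ ^ 2) := by
    intro x
    unfold heatKernel
    congr 2
    field_simp
  simp_rw [heq]
  rw [← ofReal_integral_eq_lintegral_ofReal (hI.const_mul _)
    (Filter.Eventually.of_forall fun x => by positivity), integral_const_mul, hint,
    finrank_euclideanSpace_fin, show Real.pi / (4 * t)⁻¹ = 4 * Real.pi * t by field_simp,
    ← Real.rpow_add (by positivity), show -(N : ℝ) / 2 + N / 2 = 0 by ring, Real.rpow_zero,
    ENNReal.ofReal_one]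

theorem statement15 (N : ℕ) (hN : 1 ≤ N) (k : ℝ) (hk : 0 < k) :
    ∃ C : ℝ, 0 < C ∧
      ∀ (x : EuclideanSpace ℝ (Fin N)) (t : ℝ), 0 < t →
        ∫⁻ y, ENNReal.ofReal (heatKernel N (x - y) t) * (‖y‖₊ : ℝ≥0∞) ^ (-(N : ℝ)) *
            ENNReal.ofReal (Real.log (Real.exp 1 + ‖y‖⁻¹) ^ (-k - 1) *
              Set.indicator (Set.Icc (0 : ℝ) 1) (fun _ => (1 : ℝ)) ‖y‖)
          ≤ ENNReal.ofReal (C * t ^ (-(N : ℝ) / 2) *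
              Real.log (Real.exp 1 + t ^ (-(1 : ℝ) / 2)) ^ (-k)) := by
  have hN0 : (0 : ℝ) < N := by exact_mod_cast hN
  have : Nonempty (Fin N) := ⟨⟨0, hN⟩⟩
  set D : ℝ := N * volume.real (Metric.ball (0 : EuclideanSpace ℝ (Fin N)) 1) with hD
  set M : ℝ := (1 + k / N) ^ k with hM
  have hD0 : 0 ≤ D := by positivity
  have hM0 : 0 < M := by positivity
  refine ⟨D * ((Real.exp 1 + 1) / k) + M, by positivity, fun x t ht => ?_⟩
  set s : ℝ := √t with hs
  have hs0 : 0 < s := Real.sqrt_pos.2 ht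
  have hst : t ^ (-(1 : ℝ) / 2) = s⁻¹ := by
    rw [hs, Real.sqrt_eq_rpow, ← Real.rpow_neg ht.le, neg_div]
  have hsN : t ^ (-(N : ℝ) / 2) = s ^ (-(N : ℝ)) := by
    rw [hs, Real.sqrt_eq_rpow, ← Real.rpow_mul ht.le]
    ring_nf
  have hLs := one_le_log_exp_one_add_inv hs0.le
  rw [hst]
  set ρ : ℝ := min s 1 with hρ
  have hρ0 : 0 < ρ := lt_min hs0 one_pos
  set f : ℝ → ℝ := (Ioc 0 ρ).indicator
    (fun r : ℝ => r ^ (-(N : ℝ)) * Real.log (Real.exp 1 + r⁻¹) ^ (-k - 1)) with hf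
  set A : ℝ := M * (t ^ (-(N : ℝ) / 2) * Real.log (Real.exp 1 + s⁻¹) ^ (-k)) with hA
  have hpt : ∀ y : EuclideanSpace ℝ (Fin N), y ≠ 0 →
      ENNReal.ofReal (heatKernel N (x - y) t) * (‖y‖₊ : ℝ≥0∞) ^ (-(N : ℝ)) *
            ENNReal.ofReal (Real.log (Real.exp 1 + ‖y‖⁻¹) ^ (-k - 1) *
              Set.indicator (Set.Icc (0 : ℝ) 1) (fun _ => (1 : ℝ)) ‖y‖) ≤
        ENNReal.ofReal (t ^ (-(N : ℝ) / 2)) * ENNReal.ofReal (f ‖y‖) +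
          ENNReal.ofReal A * ENNReal.ofReal (heatKernel N (x - y) t) := by
    intro y hy
    have hr : 0 < ‖y‖ := norm_pos_iff.2 hy
    have hLr := one_le_log_exp_one_add_inv hr.le
    by_cases hr1 : ‖y‖ ≤ 1
    swap
    · rw [indicator_of_notMem (fun h => hr1 h.2)]
      simp
    have hcoe : (‖y‖₊ : ℝ≥0∞) ^ (-(N : ℝ)) = ENNReal.ofReal (‖y‖ ^ (-(N : ℝ))) := by
      rw [← ENNReal.ofReal_rpow_of_pos hr, ofReal_norm]
      rfl
    rw [indicator_of_mem (show ‖y‖ ∈ Icc (0 : ℝ) 1 from ⟨hr.le, hr1⟩), mul_one, hcoe, mul_assoc,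
      ← ENNReal.ofReal_mul (by positivity)]
    by_cases hrρ : ‖y‖ ≤ ρ
    · refine le_add_right ?_
      rw [hf, indicator_of_mem (show ‖y‖ ∈ Ioc 0 ρ from ⟨hr, hrρ⟩)]
      gcongr
      exact heatKernel_le _ ht
    · refine le_add_left ?_
      rw [mul_comm]
      gcongr
      have hsr : s ≤ ‖y‖ := by
        by_contra! h
        exact hrρ (le_min h.le hr1)
      rw [hA, hsN]
      refine le_trans ?_ (rpow_neg_mul_log_rpow_neg_le hN0 hk hs0 hsr)
      gcongr
      linarith
  have hae : ∀ᵐ y : EuclideanSpace ℝ (Fin N), y ≠ 0 := by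
    simp [ae_iff]
  have hmeas : Measurable f := Measurable.indicator (by fun_prop) measurableSet_Ioc
  have hheat : ∫⁻ y, ENNReal.ofReal (heatKernel N (x - y) t) = 1 := by
    rw [lintegral_sub_left_eq_self (fun z => ENNReal.ofReal (heatKernel N z t)) x,
      lintegral_heatKernel N ht]
  have hLρ : Real.log (Real.exp 1 + ρ⁻¹) ^ (-k) ≤ Real.log (Real.exp 1 + s⁻¹) ^ (-k) :=
    Real.rpow_le_rpow_of_nonpos (by positivity)
      (log_exp_one_add_inv_anti hρ0 (min_le_left _ _)) (by linarith)
  refine (lintegral_mono_ae (hae.mono hpt)).trans ?_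
  rw [lintegral_add_left (by fun_prop), lintegral_const_mul' _ _ ENNReal.ofReal_ne_top,
    lintegral_const_mul' _ _ ENNReal.ofReal_ne_top, hheat, mul_one]
  grw [lintegral_norm_rpow_mul_log_le hN hk hρ0 (min_le_right _ _), hLρ]
  rw [← ENNReal.ofReal_mul (by positivity), ← ENNReal.ofReal_add (by positivity) (by positivity)]
  refine (congrArg ENNReal.ofReal ?_).le
  rw [hA]
  ring
end
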